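/- Let P be the topological space whose underlying set is ℝ ⊔ {p} (a single point p added to the real line) and whose open sets are exactly the open subsets of ℝ together with P itself. Then every continuous map from P to a T1 topological space is constant. Consequently, the pushout in the category of compactly generated weak Hausdorff spaces of the diagram ℝ ← ℝ×ℝ → S² (left map the first projection, right map the embedding φ of ℝ² into S² = D²/S¹ described by φ(x,y) = (x/(1+√(x²+y²)), y/(1+√(x²+y²))) followed by the boundary collapse) is a one-point space. -/

import Mathlib

set_option maxHeartbeats 1000000
/-- A topological space is a k-space (compactly generated) when a set is closed as soon as
its preimage under every continuous map from a compact Hausdorff space is closed. -/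
def IsKSpace (X : Type) [TopologicalSpace X] : Prop :=
  ∀ A : Set X, (∀ (K : Type) [TopologicalSpace K] [CompactSpace K] [T2Space K]
    (f : K → X), Continuous f → IsClosed (f ⁻¹' A)) → IsClosed A

/-- A topological space is weak Hausdorff when the image of every continuous map
from a compact Hausdorff space is closed. -/
def IsWeakHausdorff (X : Type) [TopologicalSpace X] : Prop :=
  ∀ (K : Type) [TopologicalSpace K] [CompactSpace K] [T2Space K] (f : K → X),
    Continuous f → IsClosed (Set.range f)

/-- Compactly generated weak Hausdorff space (weak Hausdorff k-space). -/
def IsCGWH (X : Type) [TopologicalSpace X] : Prop :=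
  IsKSpace X ∧ IsWeakHausdorff X
/-- The underlying set of the space `P`: the real line with one extra point `p` added. -/
def Pt : Type := ℝ ⊕ PUnit

/-- The extra point `p` of `P`. -/
def Pt.infty : Pt := Sum.inr PUnit.unit

/-- The inclusion of the real line into `P`. -/
def Pt.ofReal (x : ℝ) : Pt := Sum.inl x

/-- The topology of `P`: a subset `Ω` is open iff either `p ∉ Ω` and `Ω` is an open
subset of `ℝ`, or `Ω` is the whole space. -/
instance : TopologicalSpace Pt where
  IsOpen Ω := Ω = Set.univ ∨ (Pt.infty ∉ Ω ∧ IsOpen {x : ℝ | Pt.ofReal x ∈ Ω})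
  isOpen_univ := Or.inl rfl
  isOpen_inter := by
    rintro s t (rfl | ⟨hs, hs'⟩) ht
    · rw [Set.univ_inter]; exact ht
    · rcases ht with rfl | ⟨ht, ht'⟩
      · rw [Set.inter_univ]; exact Or.inr ⟨hs, hs'⟩
      · refine Or.inr ⟨fun h => hs h.1, ?_⟩
        have : {x : ℝ | Pt.ofReal x ∈ s ∩ t} =
            {x : ℝ | Pt.ofReal x ∈ s} ∩ {x : ℝ | Pt.ofReal x ∈ t} := rfl
        rw [this]; exact hs'.inter ht'
  isOpen_sUnion := by
    intro S hS
    by_cases h : ∃ s ∈ S, s = Set.univ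
    · obtain ⟨s, hsS, rfl⟩ := h
      left
      exact Set.eq_univ_of_univ_subset (Set.subset_sUnion_of_mem hsS)
    · push_neg at h
      right
      constructor
      · rintro ⟨s, hsS, hs⟩
        rcases hS s hsS with rfl | ⟨hs', _⟩
        · exact h _ hsS rfl
        · exact hs' hs
      · have : {x : ℝ | Pt.ofReal x ∈ ⋃₀ S} = ⋃ s ∈ S, {x : ℝ | Pt.ofReal x ∈ s} := by
          ext x; simp [Set.mem_sUnion]
        rw [this]
        refine isOpen_biUnion fun s hsS => ?_
        rcases hS s hsS with rfl | ⟨_, hs'⟩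
        · exact (h _ hsS rfl).elim
        · exact hs'
noncomputable section

/-- The Euclidean plane. -/
abbrev E2 : Type := EuclideanSpace ℝ (Fin 2)

/-- The Euclidean space `ℝ³`. -/
abbrev E3 : Type := EuclideanSpace ℝ (Fin 3)

/-- The closed unit disk `D²`. -/
abbrev Disk : Type := Metric.closedBall (0 : E2) 1

/-- The unit sphere `S²`. -/
abbrev Sph : Type := Metric.sphere (0 : E3) 1

/-- The homeomorphism of the plane onto the open unit disk,
`(x,y) ↦ (x/(1+√(x²+y²)), y/(1+√(x²+y²)))`. -/
def psi (v : E2) : E2 := (1 + ‖v‖)⁻¹ • v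

theorem psi_mem_disk (v : E2) : psi v ∈ Metric.closedBall (0 : E2) 1 := by
  have h0 : (0 : ℝ) ≤ ‖v‖ := norm_nonneg v
  have h1 : (0 : ℝ) < 1 + ‖v‖ := by linarith
  rw [Metric.mem_closedBall, dist_zero_right, psi, norm_smul, norm_inv, Real.norm_eq_abs,
    abs_of_pos h1, inv_mul_le_one₀] <;> linarith

/-- The map `ψ` viewed as a map into the closed disk. -/
def psiD (v : E2) : Disk := ⟨psi v, psi_mem_disk v⟩

end
theorem Pt.infty_mem_of_isClosed {s : Set Pt} (hs : IsClosed s) (hne : s.Nonempty) :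
    Pt.infty ∈ s := by
  rcases hs.isOpen_compl with h | ⟨h, -⟩
  · rw [Set.compl_univ_iff] at h
    exact absurd h hne.ne_empty
  · exact not_not.mp h

theorem Pt.eq_of_continuous {W : Type*} [TopologicalSpace W] [T1Space W] {f : Pt → W}
    (hf : Continuous f) (a b : Pt) : f a = f b := by
  have key (a : Pt) : f Pt.infty = f a :=
    Pt.infty_mem_of_isClosed (isClosed_singleton.preimage hf) ⟨a, rfl⟩
  rw [← key a, key b]

theorem IsWeakHausdorff.t1Space {X : Type} [TopologicalSpace X] (h : IsWeakHausdorff X) :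
    T1Space X where
  t1 x := by
    simpa [Set.range_const] using h PUnit (fun _ => x) continuous_const

theorem norm_psi (v : E2) : ‖psi v‖ = ‖v‖ / (1 + ‖v‖) := by
  have : 0 < 1 + ‖v‖ := by positivity
  rw [psi, norm_smul, norm_inv, Real.norm_of_nonneg this.le, inv_mul_eq_div]

theorem tendsto_norm_psi : Filter.Tendsto (fun v : E2 => ‖psi v‖) (Filter.comap norm Filter.atTop)
    (nhds 1) := by
  have h : Filter.Tendsto (fun r : ℝ => 1 - (1 + r)⁻¹) Filter.atTop (nhds 1) := by
    simpa using (tendsto_inv_atTop_zero.comp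
      (Filter.tendsto_atTop_add_const_left Filter.atTop (1 : ℝ) Filter.tendsto_id)).const_sub 1
  refine (h.comp Filter.tendsto_comap).congr fun v => ?_
  have : 1 + ‖v‖ ≠ 0 := by positivity
  rw [norm_psi, Function.comp_apply]
  field_simp
  ring

theorem exists_psi_eq {d : E2} (hd : ‖d‖ < 1) : ∃ v, psi v = d := by
  have h : 0 < 1 - ‖d‖ := sub_pos.mpr hd
  refine ⟨(1 - ‖d‖)⁻¹ • d, ?_⟩
  rw [psi, norm_smul, norm_inv, Real.norm_of_nonneg h.le, smul_smul]
  convert one_smul ℝ d using 2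
  field_simp
  ring

/-- A closed subset of the disk containing the image of a vertical line meets the boundary. -/
theorem exists_norm_eq_one_of_psiD_mem {A : Set Disk} (hA : IsClosed A) (s : ℝ)
    (h : ∀ t : ℝ, psiD !₂[s, t] ∈ A) : ∃ d ∈ A, ‖d.1‖ = 1 := by
  have hclosed : IsClosed ((fun d : Disk => ‖d.1‖) '' A) :=
    (hA.isCompact.image (by fun_prop)).isClosed
  have hline : Filter.Tendsto (fun t : ℝ => !₂[s, t]) Filter.atTop
      (Filter.comap (norm : E2 → ℝ) Filter.atTop) := by
    refine Filter.tendsto_comap_iff.mpr (Filter.tendsto_atTop_mono (fun t => ?_) Filter.tendsto_id)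
    exact (le_abs_self t).trans (by simpa using PiLp.norm_apply_le !₂[s, t] 1)
  exact hclosed.mem_of_tendsto (tendsto_norm_psi.comp hline)
    (Filter.Eventually.of_forall fun t => ⟨_, h t, rfl⟩)

/-- (1) Every continuous map from `P` (the line with the point `p` attached in the
indiscrete-like way described above) to a T1 topological space is constant.
(2) Consequently the pushout, in the category of compactly generated weak Hausdorff
spaces, of the diagram `ℝ ← ℝ×ℝ → S²` (first projection on the left, the map
`φ = c ∘ ψ` on the right) is a one-point space: the one-point space enjoys the
corresponding universal property among compactly generated weak Hausdorff spaces. -/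
theorem continuous_map_from_P_constant_and_cgwh_pushout_is_point
    (c : Disk → Sph) (hc_cont : Continuous c) (hc_quot : Topology.IsQuotientMap c)
    (hc_fib : ∀ u v : Disk, c u = c v ↔ (u = v ∨ (‖u.1‖ = 1 ∧ ‖v.1‖ = 1)))
    (p : Sph) (hp : ∀ u : Disk, ‖u.1‖ = 1 → c u = p) :
    (∀ (W : Type) [TopologicalSpace W] [T1Space W] (f : Pt → W),
      Continuous f → ∀ a b : Pt, f a = f b) ∧
    (∀ (W : Type) [TopologicalSpace W], IsCGWH W →
      ∀ (u : ℝ → W) (v : Sph → W), Continuous u → Continuous v →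
      (∀ x : E2, u (x 0) = v (c (psiD x))) →
      ∃! w : W, (∀ x : ℝ, u x = w) ∧ (∀ z : Sph, v z = w)) := by
  refine ⟨fun W _ _ f hf => Pt.eq_of_continuous hf, fun W _ hW u v _ hv huv => ?_⟩
  have := hW.2.t1Space
  have hu (s : ℝ) : u s = v p := by
    obtain ⟨d, hd, hd1⟩ := exists_norm_eq_one_of_psiD_mem
      ((isClosed_singleton (x := u s)).preimage (hv.comp hc_cont)) s
      fun t => by simpa using (huv !₂[s, t]).symm
    rw [← hp d hd1]
    exact hd.symm
  refine ⟨v p, ⟨hu, fun z => ?_⟩, fun w hw => (hw.2 p).symm⟩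
  obtain ⟨d, rfl⟩ := hc_quot.surjective z
  rcases (mem_closedBall_zero_iff.mp d.2).lt_or_eq with hd | hd
  · obtain ⟨x, hx⟩ := exists_psi_eq hd
    rw [← hu (x 0), huv x, show psiD x = d from Subtype.ext hx]
  · rw [hp d hd]
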